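/- arXiv:1005.0812 — 3 statements merged into one kernel-verified Lean document; each statement's English description precedes it below -/
import Mathlib

section
/- Let X = (X₁,…,X_M) be a centered Gaussian vector in ℝ^M with nonsingular covariance matrix. For b large enough that P(max_i X_i > b) > 0, let 𝒬*_b be the conditional law of X given max_{1≤i≤M} X_i > b, and let 𝒬_b(B) = Σ_{i=1}^M p(i,b) P(X ∈ B | X_i > b) for Borel B ⊂ ℝ^M, where p(i,b) = P(X_i > b)/Σ_{j=1}^M P(X_j > b). Then the total variation distance d_TV(𝒬*_b, 𝒬_b) = sup_{B Borel} |𝒬*_b(B) − 𝒬_b(B)| tends to 0 as b → ∞. -/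
open MeasureTheory ProbabilityTheory Filter
open scoped Matrix

/-- The upper tail of a centered Gaussian law is bounded by a Gaussian factor times the upper
tail of a centered Gaussian law with larger variance. -/
lemma exists_gaussianReal_Ioi_le {v w : NNReal} (hv : 0 < v) (hvw : v < w) :
    ∃ C κ : ℝ, 0 < κ ∧ ∀ b : ℝ, 0 ≤ b →
      (gaussianReal 0 v).real (Set.Ioi b) ≤
        C * Real.exp (-(κ * b ^ 2)) * (gaussianReal 0 w).real (Set.Ioi b) := by
  have hw : 0 < w := hv.trans hvw
  have hv' : (0 : ℝ) < v := hv
  have hw' : (0 : ℝ) < w := hw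
  have hvw' : (v : ℝ) < w := hvw
  have hκ : 0 < 1 / (2 * (v : ℝ)) - 1 / (2 * w) :=
    sub_pos.2 (one_div_lt_one_div_of_lt (by positivity) (by linarith))
  refine ⟨√(2 * Real.pi * w) / √(2 * Real.pi * v), 1 / (2 * (v : ℝ)) - 1 / (2 * w), hκ, ?_⟩
  intro b hb
  set κ := 1 / (2 * (v : ℝ)) - 1 / (2 * w) with hκ_def
  set C := √(2 * Real.pi * w) / √(2 * Real.pi * v)
  have hC : 0 ≤ C * Real.exp (-(κ * b ^ 2)) := by positivity
  have hpdf : ∀ x ∈ Set.Ioi b, gaussianPDF 0 v x ≤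
      ENNReal.ofReal (C * Real.exp (-(κ * b ^ 2))) * gaussianPDF 0 w x := by
    intro x hx
    rw [gaussianPDF, gaussianPDF, ← ENNReal.ofReal_mul hC]
    apply ENNReal.ofReal_le_ofReal
    have hxb : b ^ 2 ≤ x ^ 2 := pow_le_pow_left₀ hb (le_of_lt hx) 2
    have hexp : Real.exp (-(x - 0) ^ 2 / (2 * v)) =
        Real.exp (-(κ * x ^ 2)) * Real.exp (-(x - 0) ^ 2 / (2 * w)) := by
      rw [← Real.exp_add]
      congr 1
      rw [hκ_def]
      ring
    have hsqrt : C * (√(2 * Real.pi * w))⁻¹ = (√(2 * Real.pi * v))⁻¹ := by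
      have : √(2 * Real.pi * w) ≠ 0 := by positivity
      simp only [C]
      field_simp
    rw [gaussianPDFReal, gaussianPDFReal, hexp, ← hsqrt]
    calc C * (√(2 * Real.pi * w))⁻¹ *
          (Real.exp (-(κ * x ^ 2)) * Real.exp (-(x - 0) ^ 2 / (2 * w)))
        ≤ C * (√(2 * Real.pi * w))⁻¹ *
          (Real.exp (-(κ * b ^ 2)) * Real.exp (-(x - 0) ^ 2 / (2 * w))) := by gcongr
      _ = _ := by ring
  have hmeas : gaussianReal 0 v (Set.Ioi b) ≤
      ENNReal.ofReal (C * Real.exp (-(κ * b ^ 2))) * gaussianReal 0 w (Set.Ioi b) := by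
    rw [gaussianReal_apply _ hv.ne', gaussianReal_apply _ hw.ne',
      ← lintegral_const_mul _ (measurable_gaussianPDF 0 w)]
    exact setLIntegral_mono ((measurable_gaussianPDF 0 w).const_mul _) hpdf
  have := ENNReal.toReal_mono
    (ENNReal.mul_ne_top ENNReal.ofReal_ne_top (measure_ne_top _ _)) hmeas
  rwa [ENNReal.toReal_mul, ENNReal.toReal_ofReal hC] at this

/-- A lower Bonferroni inequality: the sum of the measures of finitely many events exceeds
the measure of their union by at most the total measure of the pairwise intersections. -/
lemma sum_measureReal_le_measureReal_iUnion_add {Ω ι : Type*} [MeasurableSpace Ω] [Fintype ι]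
    [DecidableEq ι] (μ : Measure Ω) [IsFiniteMeasure μ] {A : ι → Set Ω}
    (hA : ∀ i, MeasurableSet (A i)) :
    ∑ i, μ.real (A i) ≤
      μ.real (⋃ i, A i) + ∑ i, ∑ j ∈ Finset.univ.erase i, μ.real (A i ∩ A j) := by
  let E : ι → Set Ω := fun i => A i \ ⋃ j ∈ Finset.univ.erase i, A j
  have hE : ∀ i, MeasurableSet (E i) := fun i =>
    (hA i).diff (Finset.measurableSet_biUnion _ fun j _ => hA j)
  have hdisj : Pairwise (Function.onFun Disjoint E) := by
    intro i j hij
    refine Set.disjoint_left.2 fun ω hi hj => hj.2 ?_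
    exact Set.mem_biUnion (Finset.mem_erase.2 ⟨hij, Finset.mem_univ i⟩) hi.1
  have hsum : ∑ i, μ.real (E i) ≤ μ.real (⋃ i, A i) := by
    rw [← measureReal_iUnion_fintype hdisj hE]
    exact measureReal_mono (Set.iUnion_mono fun i => Set.sdiff_subset)
  have hcover : ∀ i, μ.real (A i) ≤
      μ.real (E i) + ∑ j ∈ Finset.univ.erase i, μ.real (A i ∩ A j) := by
    intro i
    have hsub : A i ⊆ E i ∪ ⋃ j ∈ Finset.univ.erase i, A i ∩ A j := by
      intro ω hω
      by_cases h : ω ∈ ⋃ j ∈ Finset.univ.erase i, A j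
      · right
        rw [← Set.inter_iUnion₂]
        exact ⟨hω, h⟩
      · exact Or.inl ⟨hω, h⟩
    calc μ.real (A i) ≤ μ.real (E i ∪ ⋃ j ∈ Finset.univ.erase i, A i ∩ A j) :=
          measureReal_mono hsub
      _ ≤ μ.real (E i) + μ.real (⋃ j ∈ Finset.univ.erase i, A i ∩ A j) :=
          measureReal_union_le _ _
      _ ≤ _ := by
          gcongr
          exact measureReal_biUnion_finset_le _ _
  calc ∑ i, μ.real (A i)
      ≤ ∑ i, (μ.real (E i) + ∑ j ∈ Finset.univ.erase i, μ.real (A i ∩ A j)) :=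
        Finset.sum_le_sum fun i _ => hcover i
    _ ≤ _ := by
        rw [Finset.sum_add_distrib]
        gcongr

/-- Conditioning on a finite union of events differs from the mixture of the conditional
laws given the individual events by at most the normalized total measure of the pairwise
intersections. -/
lemma abs_cond_iUnion_sub_mixture_le {Ω ι : Type*} [MeasurableSpace Ω] [Fintype ι]
    [DecidableEq ι] (μ : Measure Ω) [IsFiniteMeasure μ] {A : ι → Set Ω}
    (hA : ∀ i, MeasurableSet (A i)) {B : Set Ω} (hB : MeasurableSet B) :
    |μ.real (B ∩ ⋃ i, A i) / μ.real (⋃ i, A i) -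
        ∑ i, μ.real (A i) / (∑ j, μ.real (A j)) * (μ.real (B ∩ A i) / μ.real (A i))| ≤
      (∑ i, ∑ j ∈ Finset.univ.erase i, μ.real (A i ∩ A j)) / ∑ i, μ.real (A i) := by
  set S := ∑ i, μ.real (A i)
  set U := μ.real (⋃ i, A i)
  set D := ∑ i, ∑ j ∈ Finset.univ.erase i, μ.real (A i ∩ A j)
  set a := μ.real (B ∩ ⋃ i, A i) with ha
  set s := ∑ i, μ.real (B ∩ A i) with hs
  have hmix : ∑ i, μ.real (A i) / S * (μ.real (B ∩ A i) / μ.real (A i)) = s / S := by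
    rw [hs, Finset.sum_div]
    refine Finset.sum_congr rfl fun i _ => ?_
    rcases eq_or_ne (μ.real (A i)) 0 with h | h
    · have : μ.real (B ∩ A i) = 0 :=
        le_antisymm (h ▸ measureReal_mono Set.inter_subset_right) measureReal_nonneg
      simp [h, this]
    · field_simp
  rw [hmix]
  have hS0 : 0 ≤ S := Finset.sum_nonneg fun i _ => measureReal_nonneg
  have hD0 : 0 ≤ D := Finset.sum_nonneg fun i _ => Finset.sum_nonneg fun j _ => measureReal_nonneg
  have haU : a ≤ U := measureReal_mono Set.inter_subset_right
  have ha0 : 0 ≤ a := measureReal_nonneg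
  have hUS : U ≤ S := measureReal_iUnion_fintype_le _
  have hSU : S ≤ U + D := sum_measureReal_le_measureReal_iUnion_add μ hA
  have has : a ≤ s := by
    rw [ha, Set.inter_iUnion]
    exact measureReal_iUnion_fintype_le _
  have hsa : s ≤ a + D := by
    have h := sum_measureReal_le_measureReal_iUnion_add μ fun i => hB.inter (hA i)
    rw [← Set.inter_iUnion] at h
    refine h.trans ?_
    exact add_le_add_right (Finset.sum_le_sum fun i _ => Finset.sum_le_sum fun j _ =>
      measureReal_mono (Set.inter_subset_inter Set.inter_subset_right Set.inter_subset_right)) _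
  rcases hS0.eq_or_lt with hS0 | hS0
  · have hU0 : U = 0 := le_antisymm (hS0 ▸ hUS) measureReal_nonneg
    simp [← hS0, hU0]
  have hU0 : 0 < U := by
    by_contra! hU0
    obtain ⟨i, -, hi⟩ := Finset.exists_ne_zero_of_sum_ne_zero hS0.ne'
    exact hi (le_antisymm ((measureReal_mono (Set.subset_iUnion A i)).trans hU0)
      measureReal_nonneg)
  have haUS : a / U - a / S ≤ D / S := by
    have : a / U - a / S = a / U * ((S - U) / S) := by field_simp
    rw [this]
    calc a / U * ((S - U) / S) ≤ 1 * ((S - U) / S) := by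
          have : 0 ≤ S - U := by linarith
          gcongr
          exact (div_le_one hU0).2 haU
      _ ≤ D / S := by
          rw [one_mul]
          gcongr
          linarith
  have h1 : a / S ≤ s / S := by gcongr
  have h2 : s / S ≤ a / S + D / S := by
    rw [← add_div]
    gcongr
  have h3 : a / S ≤ a / U := by gcongr
  rw [abs_le]
  constructor <;> linarith

/-- A linear form of a centered Gaussian vector with positive definite covariance matrix is a
centered Gaussian variable whose variance is given by the covariance form, which is positive on
nonzero vectors. -/
lemma exists_variance_quadraticForm {Ω : Type*} [MeasurableSpace Ω] {μ : Measure Ω}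
    {ι : Type*} [Fintype ι] [DecidableEq ι] {X : Ω → ι → ℝ} (hX : Measurable X)
    (hGauss : ∀ c : ι → ℝ, ∃ v : NNReal,
      μ.map (fun ω => ∑ i, c i * X ω i) = gaussianReal 0 v)
    (hpos : Matrix.PosDef (Matrix.of fun i j : ι => ∫ ω, X ω i * X ω j ∂μ))
    (c : ι → ℝ) :
    ∃ v : NNReal, μ.map (fun ω => ∑ i, c i * X ω i) = gaussianReal 0 v ∧
      (v : ℝ) = ∑ i, ∑ j, c i * c j * ∫ ω, X ω i * X ω j ∂μ ∧ (c ≠ 0 → 0 < v) := by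
  have hXi : ∀ i, Measurable fun ω => X ω i := fun i => (measurable_pi_apply i).comp hX
  have hL2 : ∀ i, MemLp (fun ω => X ω i) 2 μ := by
    intro i
    obtain ⟨v, hv⟩ := hGauss (Pi.single i 1)
    have hcoord : (fun ω => ∑ j, (Pi.single i 1 : ι → ℝ) j * X ω j) = fun ω => X ω i := by
      ext ω
      simp [Pi.single_apply]
    rw [hcoord] at hv
    have hid : MemLp id 2 (μ.map fun ω => X ω i) := by
      rw [hv]
      exact memLp_id_gaussianReal 2
    exact (memLp_map_measure_iff (by fun_prop) (hXi i).aemeasurable).1 hid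
  obtain ⟨v, hv⟩ := hGauss c
  have hint : ∀ i j, Integrable (fun ω => X ω i * X ω j) μ :=
    fun i j => (hL2 i).integrable_mul (hL2 j)
  have hvar : (v : ℝ) = ∑ i, ∑ j, c i * c j * ∫ ω, X ω i * X ω j ∂μ := by
    have hsq : (v : ℝ) = ∫ x, x ^ 2 ∂(gaussianReal 0 v) := by
      have h := variance_of_integral_eq_zero (μ := gaussianReal 0 v) (X := fun x => x)
        (by fun_prop) integral_id_gaussianReal
      rw [variance_fun_id_gaussianReal] at h
      exact h
    rw [hsq, ← hv, integral_map (by fun_prop) (by fun_prop)]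
    calc ∫ ω, (∑ i, c i * X ω i) ^ 2 ∂μ
        = ∫ ω, ∑ i, ∑ j, c i * c j * (X ω i * X ω j) ∂μ := by
          congr 1
          ext ω
          rw [sq, Finset.sum_mul_sum]
          refine Finset.sum_congr rfl fun i _ => Finset.sum_congr rfl fun j _ => ?_
          ring
      _ = _ := by
          rw [integral_finsetSum _ fun i _ =>
            integrable_finsetSum _ fun j _ => (hint i j).const_mul _]
          refine Finset.sum_congr rfl fun i _ => ?_
          rw [integral_finsetSum _ fun j _ => (hint i j).const_mul _]
          exact Finset.sum_congr rfl fun j _ => integral_const_mul _ _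
  refine ⟨v, hv, hvar, fun hc => ?_⟩
  have h := hpos.dotProduct_mulVec_pos hc
  have hform : star c ⬝ᵥ
      (Matrix.of fun i j : ι => ∫ ω, X ω i * X ω j ∂μ) *ᵥ c = (v : ℝ) := by
    rw [hvar]
    simp only [dotProduct, Matrix.mulVec, Matrix.of_apply, Finset.mul_sum, star_trivial]
    refine Finset.sum_congr rfl fun i _ => Finset.sum_congr rfl fun j _ => ?_
    ring
  rw [hform] at h
  exact_mod_cast h

/-- For distinct coordinates of a nondegenerate centered Gaussian vector, joint exceedance of a
high level is negligible compared with the sum of the exceedance probabilities. -/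
lemma tendsto_joint_exceedance_div_sum {Ω : Type*} [MeasurableSpace Ω] {μ : Measure Ω}
    [IsFiniteMeasure μ] {ι : Type*} [Fintype ι] [DecidableEq ι] {X : Ω → ι → ℝ}
    (hX : Measurable X)
    (hGauss : ∀ c : ι → ℝ, ∃ v : NNReal,
      μ.map (fun ω => ∑ i, c i * X ω i) = gaussianReal 0 v)
    (hpos : Matrix.PosDef (Matrix.of fun i j : ι => ∫ ω, X ω i * X ω j ∂μ))
    {i j : ι} (hij : i ≠ j) :
    Tendsto (fun b : ℝ => μ.real ({ω | X ω i > b} ∩ {ω | X ω j > b}) /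
      ∑ k, μ.real {ω | X ω k > b}) atTop (nhds 0) := by
  let q : (ι → ℝ) → ℝ := fun c => ∑ i, ∑ j, c i * c j * ∫ ω, X ω i * X ω j ∂μ
  have hlaw : ∀ c : ι → ℝ, c ≠ 0 → ∃ v : NNReal, 0 < v ∧ (v : ℝ) = q c ∧
      ∀ b : ℝ, μ.real {ω | ∑ i, c i * X ω i > b} = (gaussianReal 0 v).real (Set.Ioi b) := by
    intro c hc
    obtain ⟨v, hv, hvar, hv0⟩ := exists_variance_quadraticForm hX hGauss hpos c
    refine ⟨v, hv0 hc, hvar, fun b => ?_⟩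
    rw [← hv, map_measureReal_apply (by fun_prop) measurableSet_Ioi]
    rfl
  have hcoord : ∀ k ω, ∑ l, (Pi.single k 1 : ι → ℝ) l * X ω l = X ω k := by
    intro k ω
    simp [Pi.single_apply]
  have hsingle : ∀ k, (Pi.single k 1 : ι → ℝ) ≠ 0 := fun k => by simp
  let m : ι → ℝ := fun l => (Pi.single i 1 : ι → ℝ) l / 2 + (Pi.single j 1 : ι → ℝ) l / 2
  let d : ι → ℝ := fun l => (Pi.single i 1 : ι → ℝ) l / 2 - (Pi.single j 1 : ι → ℝ) l / 2
  have hm : m ≠ 0 := fun h => by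
    have := congrFun h i
    simp [m, hij] at this
  have hd : d ≠ 0 := fun h => by
    have := congrFun h i
    simp [d, hij] at this
  have hpar : q m + q d = (q (Pi.single i 1) + q (Pi.single j 1)) / 2 := by
    simp only [q, ← Finset.sum_add_distrib, Finset.sum_div]
    refine Finset.sum_congr rfl fun k _ => Finset.sum_congr rfl fun l _ => ?_
    simp only [m, d]
    ring
  obtain ⟨v, hv0, hv, htail⟩ := hlaw m hm
  obtain ⟨u, hu0, hu, -⟩ := hlaw d hd
  have hqd : 0 < q d := hu ▸ NNReal.coe_pos.2 hu0
  have hk : ∃ k, q m < q (Pi.single k 1) := by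
    by_contra! h
    linarith [h i, h j]
  obtain ⟨k, hk⟩ := hk
  obtain ⟨w, -, hw, htailk⟩ := hlaw _ (hsingle k)
  simp only [hcoord] at htailk
  have hvw : v < w := by
    rw [← NNReal.coe_lt_coe, hv, hw]
    exact hk
  obtain ⟨C, κ, hκ, hbound⟩ := exists_gaussianReal_Ioi_le hv0 hvw
  have hlim : Tendsto (fun b : ℝ => |C| * Real.exp (-(κ * b ^ 2))) atTop (nhds 0) := by
    have h : Tendsto (fun b : ℝ => κ * b ^ 2) atTop atTop :=
      (tendsto_pow_atTop two_ne_zero).const_mul_atTop hκ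
    simpa using (Real.tendsto_exp_neg_atTop_nhds_zero.comp h).const_mul |C|
  refine squeeze_zero' (Eventually.of_forall fun b => by positivity) ?_ hlim
  filter_upwards [eventually_ge_atTop 0] with b hb
  have hS0 : 0 ≤ ∑ k, μ.real {ω | X ω k > b} :=
    Finset.sum_nonneg fun i _ => measureReal_nonneg
  refine div_le_of_le_mul₀ hS0 (by positivity) ?_
  have hsub : {ω | X ω i > b} ∩ {ω | X ω j > b} ⊆ {ω | ∑ l, m l * X ω l > b} := by
    rintro ω ⟨hi, hj⟩
    have hmean : ∑ l, m l * X ω l = X ω i / 2 + X ω j / 2 := by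
      rw [← hcoord i ω, ← hcoord j ω, Finset.sum_div, Finset.sum_div, ← Finset.sum_add_distrib]
      refine Finset.sum_congr rfl fun l _ => ?_
      simp only [m]
      ring
    simp only [Set.mem_ofPred_eq] at hi hj ⊢
    linarith
  calc μ.real ({ω | X ω i > b} ∩ {ω | X ω j > b})
      ≤ μ.real {ω | ∑ l, m l * X ω l > b} := measureReal_mono hsub
    _ ≤ C * Real.exp (-(κ * b ^ 2)) * μ.real {ω | X ω k > b} := by
        rw [htail, htailk]
        exact hbound b hb
    _ ≤ |C| * Real.exp (-(κ * b ^ 2)) * ∑ k, μ.real {ω | X ω k > b} := by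
        gcongr
        · exact le_abs_self C
        · exact Finset.single_le_sum (f := fun k => μ.real {ω | X ω k > b})
            (fun _ _ => measureReal_nonneg) (Finset.mem_univ k)

/-- For a centered Gaussian vector `X` in `ℝ^M` with nonsingular covariance
matrix, the total variation distance between the conditional law `𝒬*_b` of `X` given
`max_i X_i > b` and the mixture `𝒬_b(B) = ∑ᵢ p(i,b) P(X ∈ B | X_i > b)`, with
`p(i,b) = P(X_i > b) / ∑_j P(X_j > b)`, tends to `0` as `b → ∞`. -/
theorem tv_distance_conditional_law_mixture_tendsto_zero
    {Ω : Type} [MeasureSpace Ω] [IsProbabilityMeasure (ℙ : Measure Ω)]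
    {M : ℕ} (hM : 0 < M)
    (X : Ω → Fin M → ℝ) (hX : Measurable X)
    (hGauss : ∀ c : Fin M → ℝ, ∃ v : NNReal,
      Measure.map (fun ω => ∑ i, c i * X ω i) (ℙ : Measure Ω) = gaussianReal 0 v)
    (hpos : Matrix.PosDef (Matrix.of fun i j : Fin M => ∫ ω, X ω i * X ω j)) :
    Tendsto
      (fun b : ℝ =>
        ⨆ B : {B : Set (Fin M → ℝ) // MeasurableSet B},
          |(ℙ ({ω | X ω ∈ B.1} ∩ {ω | ∃ i, X ω i > b})).toReal /
              (ℙ {ω | ∃ i, X ω i > b}).toReal -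
            ∑ i : Fin M,
              ((ℙ {ω | X ω i > b}).toReal / ∑ j : Fin M, (ℙ {ω | X ω j > b}).toReal) *
                ((ℙ ({ω | X ω ∈ B.1} ∩ {ω | X ω i > b})).toReal /
                  (ℙ {ω | X ω i > b}).toReal)|)
      atTop (nhds 0) := by
  have hXi : ∀ (i : Fin M) (b : ℝ), MeasurableSet {ω | X ω i > b} := fun i b =>
    measurableSet_lt measurable_const ((measurable_pi_apply i).comp hX)
  have hlim : Tendsto (fun b : ℝ =>
      (∑ i, ∑ j ∈ Finset.univ.erase i,
        (ℙ : Measure Ω).real ({ω | X ω i > b} ∩ {ω | X ω j > b})) /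
        ∑ i, (ℙ : Measure Ω).real {ω | X ω i > b}) atTop (nhds 0) := by
    simp only [Finset.sum_div]
    rw [← Finset.sum_const_zero (s := (Finset.univ : Finset (Fin M)))]
    refine tendsto_finsetSum _ fun i _ => ?_
    rw [← Finset.sum_const_zero (s := Finset.univ.erase i)]
    refine tendsto_finsetSum _ fun j hj => ?_
    exact tendsto_joint_exceedance_div_sum hX hGauss hpos (Finset.ne_of_mem_erase hj).symm
  refine squeeze_zero (fun b => Real.iSup_nonneg fun B => abs_nonneg _) (fun b => ?_) hlim
  refine Real.iSup_le (fun B => ?_) (by positivity)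
  have h := abs_cond_iUnion_sub_mixture_le (ℙ : Measure Ω) (fun i => hXi i b) (hX B.2)
  rw [← Set.ofPred_exists] at h
  exact h
end

section
/- Let X = (X₁,…,X_M) be a centered Gaussian vector in ℝ^M with nonsingular covariance matrix, and for b ∈ ℝ let 𝒬_b(B) = Σ_{i=1}^M p(i,b) P(X ∈ B | X_i > b) with p(i,b) = P(X_i > b)/Σ_{j=1}^M P(X_j > b). Define L_b : ℝ^M → ℝ by L_b(x) = (Σ_{j=1}^M P(X_j > b)) / (Σ_{j=1}^M 1(x_j > b)) on {x : max_j x_j > b} (and 0 elsewhere; 𝒬_b-almost surely the denominator is at least 1). Then: (i) ∫ L_b d𝒬_b = P(max_{1≤j≤M} X_j > b); (ii) ∫ L_b² d𝒬_b ≤ (Σ_{j=1}^M P(X_j > b))²; and (iii) Var_{𝒬_b}(L_b) / P(max_{1≤j≤M} X_j > b)² → 0 as b → ∞. -/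
open MeasureTheory ProbabilityTheory Filter
open scoped Classical

noncomputable section

/-- The importance sampling (mixture) measure
`𝒬_b = ∑ᵢ p(i,b) • ℙ[· | Xᵢ > b]`, with `p(i,b) = P(Xᵢ > b) / ∑ⱼ P(Xⱼ > b)`. -/
def mixtureQ {Ω : Type} [MeasureSpace Ω] {M : ℕ} (X : Ω → Fin M → ℝ) (b : ℝ) :
    Measure Ω :=
  ∑ i : Fin M,
    ENNReal.ofReal
        ((ℙ {ω | X ω i > b}).toReal / ∑ j : Fin M, (ℙ {ω | X ω j > b}).toReal) •
      (ℙ : Measure Ω)[|{ω | X ω i > b}]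

/-- The importance sampling estimator
`L_b = (∑ⱼ P(Xⱼ > b)) / (∑ⱼ 1(Xⱼ > b))` on `{max_j X_j > b}`, and `0` elsewhere. -/
def isEstimator {Ω : Type} [MeasureSpace Ω] {M : ℕ} (X : Ω → Fin M → ℝ) (b : ℝ)
    (ω : Ω) : ℝ :=
  if ∃ j, X ω j > b then
    (∑ j : Fin M, (ℙ {ω' | X ω' j > b}).toReal) /
      ((Finset.univ.filter fun j : Fin M => X ω j > b).card : ℝ)
  else 0

lemma gaussianReal_real_Ioi_le (v : NNReal) {t : ℝ} (ht : 0 ≤ t) (b : ℝ) :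
    (gaussianReal 0 v).real (Set.Ioi b) ≤ Real.exp (-t * b + v * t ^ 2 / 2) := by
  calc (gaussianReal 0 v).real (Set.Ioi b)
      ≤ (gaussianReal 0 v).real {x | b ≤ id x} :=
        measureReal_mono fun x (hx : b < x) => show b ≤ x from hx.le
    _ ≤ Real.exp (-t * b) * mgf id (gaussianReal 0 v) t :=
        measure_ge_le_exp_mul_mgf b ht (integrable_exp_mul_gaussianReal t)
    _ = Real.exp (-t * b + v * t ^ 2 / 2) := by
        rw [mgf_id_gaussianReal, ← Real.exp_add]; simp

lemma le_gaussianReal_real_Ioi {v : NNReal} (hv : v ≠ 0) {b : ℝ} (hb : 0 ≤ b) :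
    (Real.sqrt (2 * Real.pi * v))⁻¹ * Real.exp (-(b + 1) ^ 2 / (2 * v)) ≤
      (gaussianReal 0 v).real (Set.Ioi b) := by
  set c := (Real.sqrt (2 * Real.pi * v))⁻¹ * Real.exp (-(b + 1) ^ 2 / (2 * v))
  have hint : c * volume.real (Set.Ioc b (b + 1)) ≤
      ∫ x in Set.Ioc b (b + 1), gaussianPDFReal 0 v x := by
    refine setIntegral_ge_of_const_le_real measurableSet_Ioc (by simp) (fun x hx => ?_)
      (integrable_gaussianPDFReal 0 v).integrableOn
    have h1 : (x - 0) ^ 2 ≤ (b + 1) ^ 2 := by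
      rw [sub_zero]
      exact pow_le_pow_left₀ (hb.trans hx.1.le) hx.2 2
    exact mul_le_mul_of_nonneg_left (Real.exp_le_exp.2 (div_le_div_of_nonneg_right
      (neg_le_neg h1) (by positivity))) (by positivity)
  calc c = c * volume.real (Set.Ioc b (b + 1)) := by simp [measureReal_def]
    _ ≤ ∫ x in Set.Ioc b (b + 1), gaussianPDFReal 0 v x := hint
    _ = (gaussianReal 0 v).real (Set.Ioc b (b + 1)) := by
        rw [measureReal_def, gaussianReal_apply_eq_integral 0 hv,
          ENNReal.toReal_ofReal
            (setIntegral_nonneg measurableSet_Ioc fun x _ => gaussianPDFReal_nonneg 0 v x)]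
    _ ≤ _ := measureReal_mono fun x hx => hx.1

lemma gaussianReal_real_Ioi_pos {v : NNReal} (hv : v ≠ 0) (b : ℝ) :
    0 < (gaussianReal 0 v).real (Set.Ioi b) := by
  refine lt_of_lt_of_le ?_ (measureReal_mono (Set.Ioi_subset_Ioi (le_max_left b 0)))
  refine lt_of_lt_of_le ?_ (le_gaussianReal_real_Ioi hv (le_max_right b 0))
  have : (0 : ℝ) < v := by exact_mod_cast pos_iff_ne_zero.2 hv
  positivity

/-- The tail of a centered Gaussian is negligible with respect to that of a centered Gaussian with
larger variance. -/
lemma tendsto_gaussianReal_tail_ratio {v w : NNReal} (hvw : v < w) :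
    Tendsto (fun b : ℝ => (gaussianReal 0 v).real (Set.Ioi b) /
      (gaussianReal 0 w).real (Set.Ioi b)) atTop (nhds 0) := by
  have hw0 : w ≠ 0 := (pos_of_gt hvw).ne'
  have hw : (0 : ℝ) < w := by exact_mod_cast pos_of_gt hvw
  have hd : (0 : ℝ) < 1 - v / w := by
    rw [sub_pos, div_lt_one hw]; exact_mod_cast hvw
  set K := Real.sqrt (2 * Real.pi * w)
  have hK : 0 < K := by positivity
  have hlim : Tendsto
      (fun b : ℝ => K * Real.exp (-((b * ((1 - v / w) * b - 2) - 1) / (2 * w)))) atTop (nhds 0) := by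
    rw [← mul_zero K]
    refine (Real.tendsto_exp_neg_atTop_nhds_zero.comp ?_).const_mul K
    refine Tendsto.atTop_div_const (by positivity) ?_
    refine tendsto_atTop_add_const_right atTop (-1) ?_
    refine tendsto_id.atTop_mul_atTop₀ ?_
    exact tendsto_atTop_add_const_right atTop (-2) (tendsto_id.const_mul_atTop hd)
  refine squeeze_zero' (Eventually.of_forall fun b => by positivity) ?_ hlim
  filter_upwards [eventually_ge_atTop 0] with b hb
  rw [div_le_iff₀ (gaussianReal_real_Ioi_pos hw0 b)]
  calc (gaussianReal 0 v).real (Set.Ioi b)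
      ≤ Real.exp (-(b / w) * b + v * (b / w) ^ 2 / 2) :=
        gaussianReal_real_Ioi_le v (by positivity) b
    _ = K * Real.exp (-((b * ((1 - v / w) * b - 2) - 1) / (2 * w))) *
          (K⁻¹ * Real.exp (-(b + 1) ^ 2 / (2 * w))) := by
        rw [mul_mul_mul_comm, mul_inv_cancel₀ hK.ne', one_mul, ← Real.exp_add]
        congr 1
        field_simp
        ring
    _ ≤ _ := by gcongr; exact le_gaussianReal_real_Ioi hw0 hb

/-- The number of coordinates of `X` exceeding `b`. -/
def exceedanceCount {Ω : Type} {M : ℕ} (X : Ω → Fin M → ℝ) (b : ℝ) (ω : Ω) : ℝ :=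
  ∑ j : Fin M, {ω' | X ω' j > b}.indicator (fun _ => (1 : ℝ)) ω

section Estimator

variable {Ω : Type} {M : ℕ} {X : Ω → Fin M → ℝ} {b : ℝ}

lemma exceedanceCount_eq_card (ω : Ω) :
    exceedanceCount X b ω = ((Finset.univ.filter fun j : Fin M => X ω j > b).card : ℝ) := by
  simp [exceedanceCount, Set.indicator_apply]

lemma exceedanceCount_nonneg (ω : Ω) : 0 ≤ exceedanceCount X b ω := by
  rw [exceedanceCount_eq_card]; positivity

lemma exceedanceCount_eq_zero {ω : Ω} (h : ¬ ∃ j, X ω j > b) : exceedanceCount X b ω = 0 := by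
  rw [exceedanceCount_eq_card, Nat.cast_eq_zero, Finset.card_eq_zero,
    Finset.filter_eq_empty_iff]
  exact fun j _ hj => h ⟨j, hj⟩

lemma one_le_exceedanceCount {ω : Ω} (h : ∃ j, X ω j > b) : 1 ≤ exceedanceCount X b ω := by
  rw [exceedanceCount_eq_card, Nat.one_le_cast, Finset.one_le_card]
  obtain ⟨j, hj⟩ := h
  exact ⟨j, by simpa using hj⟩

lemma exceedanceCount_le_one_add_pairs (ω : Ω) :
    exceedanceCount X b ω ≤ {ω' | ∃ i, X ω' i > b}.indicator (fun _ => (1 : ℝ)) ω +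
      ∑ i : Fin M, ∑ j ∈ Finset.univ.erase i,
        {ω' | X ω' i > b ∧ X ω' j > b}.indicator (fun _ => (1 : ℝ)) ω := by
  have hnn : ∀ i j, 0 ≤ {ω' | X ω' i > b ∧ X ω' j > b}.indicator (fun _ => (1 : ℝ)) ω :=
    fun i j => Set.indicator_nonneg (fun _ _ => zero_le_one) _
  by_cases h : ∃ i, X ω i > b
  · obtain ⟨k, hk⟩ := h
    have hU : {ω' | ∃ i, X ω' i > b}.indicator (fun _ => (1 : ℝ)) ω = 1 :=
      Set.indicator_of_mem (show ω ∈ {ω' | ∃ i, X ω' i > b} from ⟨k, hk⟩) _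
    rw [hU, exceedanceCount, ← Finset.add_sum_erase _ _ (Finset.mem_univ k)]
    refine add_le_add (by simp [hk]) ?_
    refine le_trans (le_of_eq ?_) (Finset.single_le_sum
      (f := fun i => ∑ j ∈ Finset.univ.erase i,
        {ω' | X ω' i > b ∧ X ω' j > b}.indicator (fun _ => (1 : ℝ)) ω)
      (fun i _ => Finset.sum_nonneg fun j _ => hnn i j) (Finset.mem_univ k))
    refine Finset.sum_congr rfl fun j _ => ?_
    simp [Set.indicator_apply, hk]
  · rw [exceedanceCount_eq_zero h]
    exact add_nonneg (Set.indicator_nonneg (fun _ _ => zero_le_one) _)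
      (Finset.sum_nonneg fun i _ => Finset.sum_nonneg fun j _ => hnn i j)

lemma measurable_exceedanceCount [MeasurableSpace Ω] (hX : Measurable X) :
    Measurable (exceedanceCount X b) := by
  unfold exceedanceCount
  refine Finset.measurable_sum _ fun j _ => measurable_const.indicator ?_
  exact measurableSet_lt measurable_const ((measurable_pi_apply j).comp hX)

lemma measurableSet_exists_gt [MeasurableSpace Ω] (hX : Measurable X) :
    MeasurableSet {ω | ∃ i, X ω i > b} := by
  rw [Set.ofPred_exists]
  exact MeasurableSet.iUnion fun j =>
    measurableSet_lt measurable_const ((measurable_pi_apply j).comp hX)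

variable [MeasureSpace Ω]

lemma isEstimator_eq_div (ω : Ω) :
    isEstimator X b ω =
      (∑ j : Fin M, (ℙ {ω' | X ω' j > b}).toReal) / exceedanceCount X b ω := by
  unfold isEstimator
  split_ifs with h
  · rw [exceedanceCount_eq_card]
  · rw [exceedanceCount_eq_zero h, div_zero]

lemma isEstimator_nonneg (ω : Ω) : 0 ≤ isEstimator X b ω := by
  rw [isEstimator_eq_div]
  exact div_nonneg (by positivity) (exceedanceCount_nonneg ω)

lemma isEstimator_le (ω : Ω) :
    isEstimator X b ω ≤ ∑ j : Fin M, (ℙ {ω' | X ω' j > b}).toReal := by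
  by_cases h : ∃ j, X ω j > b
  · rw [isEstimator_eq_div]
    exact div_le_self (by positivity) (one_le_exceedanceCount h)
  · rw [isEstimator, if_neg h]; positivity

lemma measurable_isEstimator (hX : Measurable X) : Measurable (isEstimator X b) := by
  have : isEstimator X b = fun ω => _ := funext isEstimator_eq_div
  rw [this]
  exact measurable_const.div (measurable_exceedanceCount hX)

lemma exceedanceCount_mul_isEstimator (ω : Ω) :
    exceedanceCount X b ω * isEstimator X b ω =
      {ω | ∃ i, X ω i > b}.indicator
        (fun _ => ∑ j : Fin M, (ℙ {ω' | X ω' j > b}).toReal) ω := by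
  by_cases h : ∃ i, X ω i > b
  · rw [Set.indicator_of_mem (by exact h), isEstimator_eq_div,
      mul_div_cancel₀ _ (zero_lt_one.trans_le (one_le_exceedanceCount h)).ne']
  · rw [Set.indicator_of_notMem (by exact h), exceedanceCount_eq_zero h, zero_mul]

lemma measure_exists_gt_le_sum :
    (ℙ {ω | ∃ i, X ω i > b}).toReal ≤ ∑ j : Fin M, (ℙ {ω | X ω j > b}).toReal := by
  rw [Set.ofPred_exists]
  exact measureReal_iUnion_fintype_le _

variable [IsProbabilityMeasure (ℙ : Measure Ω)]

lemma mixtureQ_eq_smul_restrict :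
    mixtureQ X b = ∑ i : Fin M,
      ENNReal.ofReal (∑ j : Fin M, (ℙ {ω | X ω j > b}).toReal)⁻¹ •
        (ℙ : Measure Ω).restrict {ω | X ω i > b} := by
  unfold mixtureQ
  refine Finset.sum_congr rfl fun i _ => ?_
  rw [ProbabilityTheory.cond]
  by_cases h : ℙ {ω | X ω i > b} = 0
  · rw [Measure.restrict_eq_zero.2 h]; simp
  · rw [smul_smul, div_eq_mul_inv, ENNReal.ofReal_mul ENNReal.toReal_nonneg,
      ENNReal.ofReal_toReal (measure_ne_top _ _), mul_right_comm,
      ENNReal.mul_inv_cancel h (measure_ne_top _ _), one_mul]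

/-- Under the mixture measure, expectations are expectations under `ℙ` weighted by the exceedance
count. -/
lemma integral_mixtureQ (hX : Measurable X) {f : Ω → ℝ} (hf : Integrable f ℙ) :
    ∫ ω, f ω ∂(mixtureQ X b) =
      (∑ j : Fin M, (ℙ {ω | X ω j > b}).toReal)⁻¹ * ∫ ω, exceedanceCount X b ω * f ω := by
  have hms : ∀ j, MeasurableSet {ω | X ω j > b} := fun j =>
    measurableSet_lt measurable_const ((measurable_pi_apply j).comp hX)
  rw [mixtureQ_eq_smul_restrict, integral_finsetSum_measure fun i _ =>
    hf.restrict.smul_measure ENNReal.ofReal_ne_top]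
  have hN : ∀ ω, exceedanceCount X b ω * f ω =
      ∑ j : Fin M, {ω | X ω j > b}.indicator f ω := fun ω => by
    rw [exceedanceCount, Finset.sum_mul]
    exact Finset.sum_congr rfl fun j _ => by simp [Set.indicator_apply]
  simp_rw [hN]
  rw [integral_finsetSum _ fun i _ => hf.indicator (hms i), Finset.mul_sum]
  refine Finset.sum_congr rfl fun i _ => ?_
  rw [integral_smul_measure, integral_indicator (hms i), ENNReal.toReal_ofReal (by positivity),
    smul_eq_mul]

lemma integral_exceedanceCount (hX : Measurable X) :
    ∫ ω, exceedanceCount X b ω = ∑ j : Fin M, (ℙ {ω | X ω j > b}).toReal := by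
  have hms : ∀ j, MeasurableSet {ω | X ω j > b} := fun j =>
    measurableSet_lt measurable_const ((measurable_pi_apply j).comp hX)
  unfold exceedanceCount
  rw [integral_finsetSum _ fun j _ => (integrable_const _).indicator (hms j)]
  refine Finset.sum_congr rfl fun j _ => ?_
  rw [integral_indicator_const _ (hms j), smul_eq_mul, mul_one, measureReal_def]

lemma integrable_isEstimator (hX : Measurable X) : Integrable (isEstimator X b) ℙ :=
  Integrable.of_bound (measurable_isEstimator hX).aestronglyMeasurable _
    (Eventually.of_forall fun ω => by
      rw [Real.norm_of_nonneg (isEstimator_nonneg ω)]; exact isEstimator_le ω)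

lemma integrable_isEstimator_sq (hX : Measurable X) :
    Integrable (fun ω => isEstimator X b ω ^ 2) ℙ :=
  Integrable.of_bound ((measurable_isEstimator hX).pow_const 2).aestronglyMeasurable
    ((∑ j : Fin M, (ℙ {ω' | X ω' j > b}).toReal) ^ 2)
    (Eventually.of_forall fun ω => by
      rw [Real.norm_of_nonneg (sq_nonneg _)]
      exact pow_le_pow_left₀ (isEstimator_nonneg ω) (isEstimator_le ω) 2)

/-- Unbiasedness of the estimator. -/
lemma integral_isEstimator (hX : Measurable X)
    (hS : ∑ j : Fin M, (ℙ {ω | X ω j > b}).toReal ≠ 0) :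
    ∫ ω, isEstimator X b ω ∂(mixtureQ X b) = (ℙ {ω | ∃ i, X ω i > b}).toReal := by
  rw [integral_mixtureQ hX (integrable_isEstimator hX)]
  simp_rw [exceedanceCount_mul_isEstimator]
  rw [integral_indicator_const _ (measurableSet_exists_gt hX), smul_eq_mul, measureReal_def,
    mul_comm, mul_assoc, mul_inv_cancel₀ hS, mul_one]

lemma integral_isEstimator_sq_le_mul (hX : Measurable X)
    (hS : ∑ j : Fin M, (ℙ {ω | X ω j > b}).toReal ≠ 0) :
    ∫ ω, isEstimator X b ω ^ 2 ∂(mixtureQ X b) ≤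
      (∑ j : Fin M, (ℙ {ω | X ω j > b}).toReal) * (ℙ {ω | ∃ i, X ω i > b}).toReal := by
  set S := ∑ j : Fin M, (ℙ {ω | X ω j > b}).toReal
  have hS0 : 0 ≤ S := by positivity
  have hms := measurableSet_exists_gt (b := b) hX
  have hle : ∫ ω, exceedanceCount X b ω * isEstimator X b ω ^ 2 ≤
      ∫ ω, {ω | ∃ i, X ω i > b}.indicator (fun _ => S ^ 2) ω := by
    refine integral_mono_of_nonneg (Eventually.of_forall fun ω =>
      mul_nonneg (exceedanceCount_nonneg ω) (sq_nonneg _))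
      ((integrable_const _).indicator hms) (Eventually.of_forall fun ω => ?_)
    dsimp only
    rw [sq, ← mul_assoc, exceedanceCount_mul_isEstimator]
    by_cases h : ω ∈ {ω | ∃ i, X ω i > b}
    · rw [Set.indicator_of_mem h, Set.indicator_of_mem h, sq]
      exact mul_le_mul_of_nonneg_left (isEstimator_le ω) hS0
    · rw [Set.indicator_of_notMem h, Set.indicator_of_notMem h, zero_mul]
  rw [integral_indicator_const _ hms, smul_eq_mul, measureReal_def] at hle
  rw [integral_mixtureQ hX (integrable_isEstimator_sq hX)]
  calc S⁻¹ * ∫ ω, exceedanceCount X b ω * isEstimator X b ω ^ 2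
      ≤ S⁻¹ * ((ℙ {ω | ∃ i, X ω i > b}).toReal * S ^ 2) := by gcongr
    _ = _ := by field_simp

lemma isProbabilityMeasure_mixtureQ (hX : Measurable X)
    (hS : ∑ j : Fin M, (ℙ {ω | X ω j > b}).toReal ≠ 0) :
    IsProbabilityMeasure (mixtureQ X b) := by
  have h := integral_mixtureQ (b := b) hX (integrable_const (1 : ℝ))
  simp only [mul_one, integral_const, smul_eq_mul] at h
  rw [integral_exceedanceCount hX, inv_mul_cancel₀ hS, measureReal_def] at h
  exact ⟨(ENNReal.toReal_eq_one_iff _).1 h⟩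

lemma sq_integral_isEstimator_le (hX : Measurable X)
    (hS : ∑ j : Fin M, (ℙ {ω | X ω j > b}).toReal ≠ 0) :
    (∫ ω, isEstimator X b ω ∂(mixtureQ X b)) ^ 2 ≤
      ∫ ω, isEstimator X b ω ^ 2 ∂(mixtureQ X b) := by
  have := isProbabilityMeasure_mixtureQ hX hS
  have hL : MemLp (isEstimator X b) 2 (mixtureQ X b) :=
    MemLp.of_bound (measurable_isEstimator hX).aestronglyMeasurable _
      (Eventually.of_forall fun ω => by
        rw [Real.norm_of_nonneg (isEstimator_nonneg ω)]; exact isEstimator_le ω)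
  have h := variance_nonneg (isEstimator X b) (mixtureQ X b)
  rw [variance_eq_sub hL] at h
  simpa using h

lemma sum_le_measure_exists_gt_add_pairs (hX : Measurable X) :
    ∑ j : Fin M, (ℙ {ω | X ω j > b}).toReal ≤ (ℙ {ω | ∃ i, X ω i > b}).toReal +
      ∑ i : Fin M, ∑ j ∈ Finset.univ.erase i,
        (ℙ {ω | X ω i > b ∧ X ω j > b}).toReal := by
  have hms := measurableSet_exists_gt (b := b) hX
  have hms2 : ∀ i j, MeasurableSet {ω | X ω i > b ∧ X ω j > b} := fun i j =>
    (measurableSet_lt measurable_const ((measurable_pi_apply i).comp hX)).inter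
      (measurableSet_lt measurable_const ((measurable_pi_apply j).comp hX))
  have hint : ∀ i j, Integrable
      ({ω | X ω i > b ∧ X ω j > b}.indicator (fun _ => (1 : ℝ))) ℙ := fun i j =>
    (integrable_const _).indicator (hms2 i j)
  have hsum : ∀ i, Integrable (fun ω => ∑ j ∈ Finset.univ.erase i,
      {ω | X ω i > b ∧ X ω j > b}.indicator (fun _ => (1 : ℝ)) ω) ℙ := fun i =>
    integrable_finsetSum _ fun j _ => hint i j
  have hU := (integrable_const (μ := (ℙ : Measure Ω)) (1 : ℝ)).indicator hms
  have h := integral_mono_of_nonneg (μ := (ℙ : Measure Ω))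
    (Eventually.of_forall fun ω => exceedanceCount_nonneg (X := X) (b := b) ω)
    (hU.add (integrable_finsetSum Finset.univ fun i _ => hsum i))
    (Eventually.of_forall fun ω => exceedanceCount_le_one_add_pairs ω)
  simp only [Pi.add_apply] at h
  rw [integral_exceedanceCount hX,
    integral_add hU (integrable_finsetSum _ fun i _ => hsum i),
    integral_finsetSum _ fun i _ => hsum i] at h
  simp_rw [integral_finsetSum _ fun j _ => hint _ j, integral_indicator_const _ (hms2 _ _),
    integral_indicator_const _ hms, smul_eq_mul, mul_one, measureReal_def] at h
  exact h

/-- The estimator is strongly efficient as soon as joint exceedances are asymptotically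
negligible. -/
lemma tendsto_relative_variance_isEstimator (hX : Measurable X)
    (hU : ∀ b, 0 < (ℙ {ω | ∃ i, X ω i > b}).toReal)
    (hpair : ∀ i j, i ≠ j → Tendsto (fun b : ℝ => (ℙ {ω | X ω i > b ∧ X ω j > b}).toReal /
      (ℙ {ω | ∃ i, X ω i > b}).toReal) atTop (nhds 0)) :
    Tendsto
      (fun b : ℝ =>
        (∫ ω, (isEstimator X b ω) ^ 2 ∂(mixtureQ X b) -
            (∫ ω, isEstimator X b ω ∂(mixtureQ X b)) ^ 2) /
          (ℙ {ω | ∃ i, X ω i > b}).toReal ^ 2)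
      atTop (nhds 0) := by
  have hS : ∀ b, ∑ j : Fin M, (ℙ {ω | X ω j > b}).toReal ≠ 0 := fun b =>
    ((hU b).trans_le measure_exists_gt_le_sum).ne'
  have hlim : Tendsto (fun b : ℝ => ∑ i : Fin M, ∑ j ∈ Finset.univ.erase i,
      (ℙ {ω | X ω i > b ∧ X ω j > b}).toReal / (ℙ {ω | ∃ i, X ω i > b}).toReal)
      atTop (nhds 0) := by
    have h := tendsto_finsetSum Finset.univ fun i _ =>
      tendsto_finsetSum (Finset.univ.erase i) fun j hj =>
        hpair i j (Finset.ne_of_mem_erase hj).symm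
    simpa using h
  refine squeeze_zero (fun b => div_nonneg
    (sub_nonneg.2 (sq_integral_isEstimator_le hX (hS b))) (sq_nonneg _)) (fun b => ?_) hlim
  rw [integral_isEstimator hX (hS b)]
  simp_rw [← Finset.sum_div]
  rw [div_le_div_iff₀ (pow_pos (hU b) 2) (hU b)]
  have h1 := integral_isEstimator_sq_le_mul hX (hS b)
  have h2 := sum_le_measure_exists_gt_add_pairs (b := b) hX
  have h3 := mul_le_mul_of_nonneg_right h2 (hU b).le
  have h4 := mul_le_mul_of_nonneg_right (sub_le_sub_right (h1.trans h3)
    ((ℙ {ω | ∃ i, X ω i > b}).toReal ^ 2)) (hU b).le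
  refine h4.trans (le_of_eq ?_)
  ring

end Estimator

section Gaussian

variable {Ω : Type} [MeasurableSpace Ω] {μ : Measure Ω} {v : NNReal} {Y : Ω → ℝ}

lemma memLp_two_of_map_eq_gaussianReal (hY : Measurable Y) (h : μ.map Y = gaussianReal 0 v) :
    MemLp Y 2 μ := by
  have h2 : MemLp id 2 (μ.map Y) := by
    rw [h]; exact memLp_id_gaussianReal' 2 (by simp)
  exact h2.comp_of_map hY.aemeasurable

lemma integral_sq_of_map_eq_gaussianReal (hY : Measurable Y) (h : μ.map Y = gaussianReal 0 v) :
    ∫ ω, Y ω ^ 2 ∂μ = v := by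
  have h2 : Var[fun x => x; gaussianReal 0 v] = v := variance_fun_id_gaussianReal
  rw [variance_of_integral_eq_zero (by fun_prop) integral_id_gaussianReal, ← h,
    integral_map hY.aemeasurable (by fun_prop)] at h2
  exact h2

lemma measure_gt_eq_gaussianReal_real (hY : Measurable Y) (h : μ.map Y = gaussianReal 0 v)
    (b : ℝ) : (μ {ω | Y ω > b}).toReal = (gaussianReal 0 v).real (Set.Ioi b) := by
  rw [measureReal_def, ← h, Measure.map_apply hY measurableSet_Ioi]
  rfl

/-- Joint exceedances of two jointly Gaussian centered variables whose difference is not degenerate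
are negligible with respect to a single exceedance of the one with larger variance. -/
lemma tendsto_joint_exceedance_ratio [IsFiniteMeasure μ] {Z : Ω → ℝ} {w u : NNReal}
    (hY : Measurable Y) (hZ : Measurable Z) (hYv : μ.map Y = gaussianReal 0 v)
    (hZw : μ.map Z = gaussianReal 0 w)
    (hYZ : μ.map (fun ω => (Y ω + Z ω) / 2) = gaussianReal 0 u)
    (hdiff : 0 < ∫ ω, Y ω ^ 2 ∂μ + ∫ ω, Z ω ^ 2 ∂μ - 2 * ∫ ω, Y ω * Z ω ∂μ) (hvw : v ≤ w) :
    Tendsto (fun b : ℝ => (μ {ω | Y ω > b ∧ Z ω > b}).toReal / (μ {ω | Z ω > b}).toReal)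
      atTop (nhds 0) := by
  have hY2 := memLp_two_of_map_eq_gaussianReal hY hYv
  have hZ2 := memLp_two_of_map_eq_gaussianReal hZ hZw
  have hW : Measurable fun ω => (Y ω + Z ω) / 2 := (hY.add hZ).div_const 2
  have hu := integral_sq_of_map_eq_gaussianReal hW hYZ
  have hexp : ∫ ω, ((Y ω + Z ω) / 2) ^ 2 ∂μ =
      (∫ ω, Y ω ^ 2 ∂μ + ∫ ω, Z ω ^ 2 ∂μ + 2 * ∫ ω, Y ω * Z ω ∂μ) / 4 := by
    have hYZi : Integrable (fun ω => Y ω * Z ω) μ := hY2.integrable_mul hZ2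
    have hsq : Integrable (fun ω => Y ω ^ 2 + Z ω ^ 2) μ :=
      hY2.integrable_sq.add hZ2.integrable_sq
    rw [← integral_const_mul, ← integral_add hY2.integrable_sq hZ2.integrable_sq,
      ← integral_add hsq (hYZi.const_mul 2), ← integral_div]
    congr 1 with ω
    ring
  rw [integral_sq_of_map_eq_gaussianReal hY hYv, integral_sq_of_map_eq_gaussianReal hZ hZw]
    at hexp hdiff
  have huw : u < w := by
    have h1 : (v : ℝ) ≤ w := by exact_mod_cast hvw
    have h2 : (u : ℝ) < w := by linarith
    exact_mod_cast h2
  refine squeeze_zero (fun b => by positivity) (fun b => ?_) (tendsto_gaussianReal_tail_ratio huw)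
  rw [← measure_gt_eq_gaussianReal_real hW hYZ, ← measure_gt_eq_gaussianReal_real hZ hZw]
  refine div_le_div_of_nonneg_right ?_ ENNReal.toReal_nonneg
  refine measureReal_mono (μ := μ) fun ω hω => ?_
  have h1 : b < Y ω := hω.1
  have h2 : b < Z ω := hω.2
  change b < (Y ω + Z ω) / 2
  linarith

end Gaussian

/-- For a centered Gaussian vector `X` in `ℝ^M` with nonsingular covariance:
(i) `∫ L_b d𝒬_b = P(max_j X_j > b)`; (ii) `∫ L_b² d𝒬_b ≤ (∑ⱼ P(Xⱼ > b))²`;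
(iii) `Var_{𝒬_b}(L_b) / P(max_j X_j > b)² → 0` as `b → ∞`. -/
theorem importance_sampling_estimator_unbiased_and_strongly_efficient
    {Ω : Type} [MeasureSpace Ω] [IsProbabilityMeasure (ℙ : Measure Ω)]
    {M : ℕ} (hM : 0 < M)
    (X : Ω → Fin M → ℝ) (hX : Measurable X)
    (hGauss : ∀ c : Fin M → ℝ, ∃ v : NNReal,
      Measure.map (fun ω => ∑ i, c i * X ω i) (ℙ : Measure Ω) = gaussianReal 0 v)
    (hpos : Matrix.PosDef (Matrix.of fun i j : Fin M => ∫ ω, X ω i * X ω j)) :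
    (∀ b : ℝ, ∫ ω, isEstimator X b ω ∂(mixtureQ X b) =
        (ℙ {ω | ∃ i, X ω i > b}).toReal) ∧
    (∀ b : ℝ, ∫ ω, (isEstimator X b ω) ^ 2 ∂(mixtureQ X b) ≤
        (∑ j : Fin M, (ℙ {ω | X ω j > b}).toReal) ^ 2) ∧
    Tendsto
      (fun b : ℝ =>
        (∫ ω, (isEstimator X b ω) ^ 2 ∂(mixtureQ X b) -
            (∫ ω, isEstimator X b ω ∂(mixtureQ X b)) ^ 2) /
          (ℙ {ω | ∃ i, X ω i > b}).toReal ^ 2)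
      atTop (nhds 0) := by
  have hm : ∀ i, Measurable fun ω => X ω i := fun i => (measurable_pi_apply i).comp hX
  have hmarg : ∀ i, ∃ v : NNReal, Measure.map (fun ω => X ω i) (ℙ : Measure Ω) =
      gaussianReal 0 v := fun i => by
    obtain ⟨v, hv⟩ := hGauss (Pi.single i 1)
    refine ⟨v, ?_⟩
    simpa [Pi.single_apply] using hv
  choose v hv using hmarg
  have hmean : ∀ i j, ∃ u : NNReal, Measure.map (fun ω => (X ω i + X ω j) / 2) (ℙ : Measure Ω) =
      gaussianReal 0 u := fun i j => by
    obtain ⟨u, hu⟩ := hGauss (Pi.single i (1 / 2) + Pi.single j (1 / 2))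
    refine ⟨u, ?_⟩
    rw [← hu]
    congr 1 with ω
    simp [Pi.single_apply, add_mul, Finset.sum_add_distrib]
    ring
  have hv0 : ∀ i, v i ≠ 0 := fun i hi => by
    have h := hpos.diag_pos (i := i)
    simp only [Matrix.of_apply, ← sq] at h
    rw [integral_sq_of_map_eq_gaussianReal (hm i) (hv i), hi] at h
    simp at h
  have hdiff : ∀ i j, i ≠ j → 0 < (∫ ω, X ω i ^ 2) + (∫ ω, X ω j ^ 2) -
      2 * ∫ ω, X ω i * X ω j := fun i j hij => by
    have hx : (Pi.single i 1 - Pi.single j 1 : Fin M → ℝ) ≠ 0 := fun h => by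
      simpa [hij] using congrFun h i
    have h := hpos.dotProduct_mulVec_pos hx
    have hcomm : ∫ ω, X ω j * X ω i = ∫ ω, X ω i * X ω j := by simp_rw [mul_comm]
    simp only [star_trivial, Matrix.mulVec_sub, Matrix.mulVec_single_one, sub_dotProduct,
      single_one_dotProduct, Pi.sub_apply, Matrix.col_apply, Matrix.of_apply, hcomm, ← sq] at h
    linarith
  have hP : ∀ i b, 0 < (ℙ {ω | X ω i > b}).toReal := fun i b => by
    rw [measure_gt_eq_gaussianReal_real (hm i) (hv i)]
    exact gaussianReal_real_Ioi_pos (hv0 i) b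
  have hPU : ∀ i b, (ℙ {ω | X ω i > b}).toReal ≤ (ℙ {ω | ∃ i, X ω i > b}).toReal := fun i b =>
    measureReal_mono (μ := (ℙ : Measure Ω)) fun ω hω => ⟨i, hω⟩
  have hU : ∀ b, 0 < (ℙ {ω | ∃ i, X ω i > b}).toReal := fun b =>
    (hP ⟨0, hM⟩ b).trans_le (hPU _ b)
  have hS : ∀ b, ∑ j : Fin M, (ℙ {ω | X ω j > b}).toReal ≠ 0 := fun b =>
    ((hU b).trans_le measure_exists_gt_le_sum).ne'
  have hpair_le : ∀ i j, i ≠ j → v i ≤ v j →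
      Tendsto (fun b : ℝ => (ℙ {ω | X ω i > b ∧ X ω j > b}).toReal /
        (ℙ {ω | ∃ i, X ω i > b}).toReal) atTop (nhds 0) := fun i j hij hvij => by
    obtain ⟨u, hu⟩ := hmean i j
    refine squeeze_zero (fun b => by positivity) (fun b => ?_)
      (tendsto_joint_exceedance_ratio (hm i) (hm j) (hv i) (hv j) hu (hdiff i j hij) hvij)
    exact div_le_div_of_nonneg_left ENNReal.toReal_nonneg (hP j b) (hPU j b)
  refine ⟨fun b => integral_isEstimator hX (hS b), fun b => ?_,
    tendsto_relative_variance_isEstimator hX hU fun i j hij => ?_⟩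
  · refine (integral_isEstimator_sq_le_mul hX (hS b)).trans ?_
    rw [sq]
    exact mul_le_mul_of_nonneg_left measure_exists_gt_le_sum (by positivity)
  · rcases le_total (v i) (v j) with h | h
    · exact hpair_le i j hij h
    · simpa only [and_comm] using hpair_le j i hij.symm h
end
end

section
/- Assume Conditions A1–A4 with Hölder exponent β. For any v > 0, let ρ = 2d/β + dv + 1. There exist constants b₀, λ ∈ (0,∞), independent of a > 0, such that for all b ≥ b₀ ≥ 1: (i) P( max_{t∈T} f(t) ≤ b + a/b | max_{t∈T} f(t) > b ) ≤ λ a b^ρ; (ii) consequently P( max_{t∈T} f(t) > γ_{a,b}, max_{t∈T} f(t) ≤ b ) ≤ λ a b^ρ · P( max_{t∈T} f(t) > γ_{a,b} ); and (iii) P( max_{t∈T} f(t) > γ_{a,b} )·(1 − λ a b^ρ) ≤ P( max_{t∈T} f(t) > b ). -/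
open MeasureTheory ProbabilityTheory Filter
open scoped Classical

noncomputable section

/-- The ℓ¹ norm `|x| = ∑ⱼ |xⱼ|` on `ℝ^d`. -/
def nrm {d : ℕ} (x : Fin d → ℝ) : ℝ := ∑ j, |x j|

section GaussianTail

lemma gaussianPDFReal_le_of_abs_le {m : ℝ} {v : NNReal} {x y : ℝ} (h : |x - m| ≤ |y - m|) :
    gaussianPDFReal m v y ≤ gaussianPDFReal m v x := by
  rw [gaussianPDFReal_def]
  have := sq_le_sq.2 h
  dsimp only
  gcongr

lemma gaussianPDFReal_le_shift {m : ℝ} {v : NNReal} (hv : v ≠ 0) {b x : ℝ} (hb : 1 ≤ b)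
    (hm : |m| ≤ b) (hxb : x ≤ b) :
    gaussianPDFReal m v x ≤ Real.exp (5 / (2 * v)) * gaussianPDFReal m v (x + 1 / b) := by
  have hv' : (0 : ℝ) < v := by positivity
  rw [gaussianPDFReal_def]
  dsimp only
  rw [mul_left_comm, ← Real.exp_add]
  gcongr
  rw [← add_div]
  gcongr
  have hb0 : 0 < b := by linarith
  have h1 : (x - m) * (1 / b) ≤ 2 := by
    rw [mul_one_div, div_le_iff₀ hb0]
    linarith [neg_abs_le m]
  have h2 : (1 / b) ^ 2 ≤ 1 := by
    rw [sq_le_one_iff₀ (by positivity), div_le_one hb0]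
    exact hb
  nlinarith

/-- The mass of a Gaussian measure in a short interval is controlled by its mass to the right of
the left endpoint (truncated at level `b`). -/
lemma gaussianReal_Icc_le (m : ℝ) {v : NNReal} (hv : v ≠ 0) {b : ℝ} (hb : 1 ≤ b) (hm : |m| ≤ b)
    (x h : ℝ) (hh : 0 ≤ h) :
    gaussianReal m v (Set.Icc x (x + h)) ≤
      ENNReal.ofReal (Real.exp (5 / (2 * v)) * h * b) *
        gaussianReal m v (Set.Ioi (min x b)) := by
  set z := max (min x b) m with hz
  have hb0 : 0 < b := by linarith
  have hmz : m ≤ z := le_max_right _ _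
  have hzb : z ≤ b := max_le (min_le_right _ _) ((le_abs_self m).trans hm)
  have hub : gaussianReal m v (Set.Icc x (x + h)) ≤
      ENNReal.ofReal (gaussianPDFReal m v z) * ENNReal.ofReal h := by
    rw [gaussianReal_apply m hv]
    calc ∫⁻ y in Set.Icc x (x + h), gaussianPDF m v y
        ≤ ∫⁻ _ in Set.Icc x (x + h), ENNReal.ofReal (gaussianPDFReal m v z) := by
          refine setLIntegral_mono measurable_const fun y hy => ?_
          refine ENNReal.ofReal_le_ofReal (gaussianPDFReal_le_of_abs_le ?_)
          rw [abs_of_nonneg (by linarith)]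
          rcases max_choice (min x b) m with h' | h'
          · rw [hz, h']
            exact (by linarith [min_le_left x b, hy.1] : min x b - m ≤ y - m).trans (le_abs_self _)
          · rw [hz, h']
            simp
      _ = _ := by simp
  have hlb : ENNReal.ofReal (gaussianPDFReal m v (z + 1 / b)) * ENNReal.ofReal (1 / b) ≤
      gaussianReal m v (Set.Ioi (min x b)) := by
    rw [gaussianReal_apply m hv]
    calc ENNReal.ofReal (gaussianPDFReal m v (z + 1 / b)) * ENNReal.ofReal (1 / b)
        = ∫⁻ _ in Set.Ioc z (z + 1 / b), ENNReal.ofReal (gaussianPDFReal m v (z + 1 / b)) := by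
          simp
      _ ≤ ∫⁻ y in Set.Ioc z (z + 1 / b), gaussianPDF m v y := by
          refine setLIntegral_mono (measurable_gaussianPDF m v) fun y hy => ?_
          refine ENNReal.ofReal_le_ofReal (gaussianPDFReal_le_of_abs_le ?_)
          rw [abs_of_nonneg (by linarith [hy.1]), abs_of_nonneg (by linarith [hy.1, hy.2])]
          linarith [hy.2]
      _ ≤ _ := lintegral_mono_set fun y hy => (le_max_left (min x b) m).trans_lt hy.1
  refine hub.trans (le_trans ?_ (mul_le_mul_right hlb _))
  have h1 := gaussianPDFReal_nonneg m v (z + 1 / b)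
  rw [← ENNReal.ofReal_mul (gaussianPDFReal_nonneg m v z), ← ENNReal.ofReal_mul h1,
    ← ENNReal.ofReal_mul (by positivity)]
  refine ENNReal.ofReal_le_ofReal ?_
  calc gaussianPDFReal m v z * h
      ≤ Real.exp (5 / (2 * v)) * gaussianPDFReal m v (z + 1 / b) * h := by
        gcongr
        exact gaussianPDFReal_le_shift hv hb hm hzb
    _ = _ := by
        field_simp

/-- A subset of an upper set `S` that misses the translate of `S` by `h` has small Gaussian mass
relative to `S` itself, up to the mass above level `b`. -/
lemma gaussianReal_le_of_isUpperSet (m : ℝ) {v : NNReal} (hv : v ≠ 0) {b : ℝ} (hb : 1 ≤ b)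
    (hm : |m| ≤ b) {h : ℝ} (hh : 0 ≤ h) {S E : Set ℝ} (hS : IsUpperSet S) (hES : E ⊆ S)
    (hE : ∀ x ∈ S, x + h ∉ E) :
    gaussianReal m v E ≤ ENNReal.ofReal (Real.exp (5 / (2 * v)) * h * b) *
      (gaussianReal m v S + gaussianReal m v (Set.Ioi b)) := by
  rcases E.eq_empty_or_nonempty with rfl | ⟨e, he⟩
  · simp
  have hbdd : BddBelow S := by
    refine ⟨e - h, fun x hx => ?_⟩
    by_contra! hlt
    refine hE (e - h) (hS hlt.le hx) ?_
    rwa [sub_add_cancel]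
  have hIoi : Set.Ioi (sInf S) ⊆ S := fun x hx => by
    obtain ⟨y, hy, hyx⟩ := exists_lt_of_csInf_lt ⟨e, hES he⟩ hx
    exact hS hyx.le hy
  have hIcc : E ⊆ Set.Icc (sInf S) (sInf S + h) := fun x hx => by
    refine ⟨csInf_le hbdd (hES hx), ?_⟩
    by_contra! hlt
    refine hE (x - h) (hIoi (by simpa [lt_sub_iff_add_lt] using hlt)) ?_
    rwa [sub_add_cancel]
  refine (measure_mono hIcc).trans ((gaussianReal_Icc_le m hv hb hm _ h hh).trans ?_)
  gcongr
  rcases min_choice (sInf S) b with h' | h' <;> rw [h']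
  · exact (measure_mono hIoi).trans le_self_add
  · exact le_add_self

end GaussianTail

/-- Conditionally on `Y`, the supremum of `k i * X + Y i` is an increasing function of the
Gaussian variable `X` with slope at least `k₀`. -/
lemma measure_sup_mem_Ioc_le {Ω ι : Type*} [MeasurableSpace Ω] {P : Measure Ω}
    [IsProbabilityMeasure P] [Countable ι] {X : Ω → ℝ} {Y : Ω → ι → ℝ} (hX : Measurable X)
    (hY : Measurable Y) (hXY : IndepFun X Y P) {m : ℝ} {v : NNReal} (hv : v ≠ 0)
    (hlaw : P.map X = gaussianReal m v) {k : ι → ℝ} {k₀ : ℝ} (hk₀ : 0 < k₀) (hk : ∀ i, k₀ ≤ k i)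
    {b h : ℝ} (hb : 1 ≤ b) (hm : |m| ≤ b) (hh : 0 ≤ h) :
    P {ω | (∃ i, b < k i * X ω + Y ω i) ∧ ∀ i, k i * X ω + Y ω i ≤ b + h} ≤
      ENNReal.ofReal (Real.exp (5 / (2 * v)) * (h / k₀) * b) *
        (P {ω | ∃ i, b < k i * X ω + Y ω i} + P {ω | b < X ω}) := by
  have hprod := (indepFun_iff_map_prod_eq_prod_map_map hY.aemeasurable hX.aemeasurable).1 hXY.symm
  have hYprob : IsProbabilityMeasure (P.map Y) := Measure.isProbabilityMeasure_map hY.aemeasurable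
  set S : Set ((ι → ℝ) × ℝ) := {p | ∃ i, b < k i * p.2 + p.1 i} with hSdef
  set E : Set ((ι → ℝ) × ℝ) := {p | (∃ i, b < k i * p.2 + p.1 i) ∧ ∀ i, k i * p.2 + p.1 i ≤ b + h}
  have hmeas : ∀ i, Measurable fun p : (ι → ℝ) × ℝ => k i * p.2 + p.1 i := fun i => by fun_prop
  have hSm : MeasurableSet S := by
    rw [hSdef, Set.ofPred_exists]
    exact .iUnion fun i => measurableSet_lt measurable_const (hmeas i)
  have hEm : MeasurableSet E := by
    have : MeasurableSet {p : (ι → ℝ) × ℝ | ∀ i, k i * p.2 + p.1 i ≤ b + h} := by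
      rw [Set.ofPred_forall]
      exact .iInter fun i => measurableSet_le (hmeas i) measurable_const
    exact hSm.inter this
  have hYX : Measurable fun ω => (Y ω, X ω) := hY.prodMk hX
  have key : ∀ A : Set ((ι → ℝ) × ℝ), MeasurableSet A → P ((fun ω => (Y ω, X ω)) ⁻¹' A) =
      ∫⁻ y, gaussianReal m v (Prod.mk y ⁻¹' A) ∂(P.map Y) := fun A hA => by
    rw [← Measure.map_apply hYX hA, hprod, hlaw, Measure.prod_apply hA]
  have hXb : P {ω | b < X ω} = gaussianReal m v (Set.Ioi b) := by
    rw [← hlaw, Measure.map_apply hX measurableSet_Ioi]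
    rfl
  change P ((fun ω => (Y ω, X ω)) ⁻¹' E) ≤ _ * (P ((fun ω => (Y ω, X ω)) ⁻¹' S) + _)
  rw [key E hEm, key S hSm, hXb]
  calc ∫⁻ y, gaussianReal m v (Prod.mk y ⁻¹' E) ∂(P.map Y)
      ≤ ∫⁻ y, ENNReal.ofReal (Real.exp (5 / (2 * v)) * (h / k₀) * b) *
          (gaussianReal m v (Prod.mk y ⁻¹' S) + gaussianReal m v (Set.Ioi b)) ∂(P.map Y) := by
        refine lintegral_mono fun y => ?_
        refine gaussianReal_le_of_isUpperSet m hv hb hm (by positivity) ?_ (fun x hx => hx.1) ?_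
        · rintro x x' hxx' ⟨i, hi⟩
          have := (hk i).trans' hk₀.le
          exact ⟨i, hi.trans_le (by dsimp only; gcongr)⟩
        · rintro x ⟨i, hi⟩ ⟨-, hx⟩
          have h1 : h ≤ k i * (h / k₀) := by
            rw [mul_div_left_comm]
            exact le_mul_of_one_le_right hh ((one_le_div hk₀).2 (hk i))
          have h2 := hx i
          dsimp only at hi h2
          linarith
    _ = _ := by
        rw [lintegral_const_mul _ (by
          exact (measurable_measure_prodMk_left hSm).add_const _),
          lintegral_add_right _ measurable_const]
        simp

lemma isGaussianProcess_of_forall_linearCombination {Ω τ : Type*} [MeasurableSpace Ω]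
    {P : Measure Ω} {X : τ → Ω → ℝ} (hX : ∀ t, Measurable (X t))
    (h : ∀ (n : ℕ) (t : Fin n → τ) (c : Fin n → ℝ), ∃ (m : ℝ) (v : NNReal),
      P.map (fun ω => ∑ i, c i * X (t i) ω) = gaussianReal m v) :
    IsGaussianProcess X P where
  hasGaussianLaw I := by
    refine ⟨isGaussian_of_map_eq_gaussianReal fun L => ?_⟩
    obtain ⟨m, v, hmv⟩ := h I.card (fun j => I.equivFin.symm j)
      (fun j => L (Pi.single (I.equivFin.symm j) 1))
    refine ⟨m, v, ?_⟩
    have hmeas : Measurable fun ω => I.restrict (X · ω) := measurable_pi_lambda _ fun i => hX i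
    rw [← hmv, Measure.map_map (by fun_prop) hmeas]
    congr 1
    ext ω
    rw [Function.comp_apply, Equiv.sum_comp I.equivFin.symm
      (fun i : I => L (Pi.single i 1) * X i ω)]
    conv_lhs => rw [← Finset.univ_sum_single (I.restrict fun t => X t ω)]
    rw [map_sum]
    refine Finset.sum_congr rfl fun i _ => ?_
    rw [mul_comm, ← smul_eq_mul, ← map_smul]
    congr 1
    ext j
    rcases eq_or_ne j i with rfl | hj <;> simp [*]

/-- If all the variables of a countable Gaussian family have covariance bounded below with a given
variable `X s` of the process, then the supremum of the family charges `(b, b + h]` by at most a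
multiple of `h * b` times the probability of exceeding level `b`. -/
lemma ProbabilityTheory.IsGaussianProcess.measure_sup_mem_Ioc_le {Ω τ ι : Type*}
    [MeasurableSpace Ω] {P : Measure Ω} [Countable ι] {X : τ → Ω → ℝ}
    (hG : IsGaussianProcess X P) (hX : ∀ t, Measurable (X t)) {s : τ} {k₀ : ℝ} (hk₀ : 0 < k₀)
    (hs : 0 < cov[X s, X s; P]) {u : ι → τ}
    (hu : ∀ i, k₀ * cov[X s, X s; P] ≤ cov[X s, X (u i); P])
    {b h : ℝ} (hb : 1 ≤ b) (hm : |∫ ω, X s ω ∂P| ≤ b) (hh : 0 ≤ h) :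
    P {ω | (∃ i, b < X (u i) ω) ∧ ∀ i, X (u i) ω ≤ b + h} ≤
      ENNReal.ofReal (Real.exp (5 / (2 * cov[X s, X s; P])) / k₀ * (h * b)) *
        (P {ω | ∃ i, b < X (u i) ω} + P {ω | b < X s ω}) := by
  have := hG.isProbabilityMeasure
  have hL2 : ∀ t, MemLp (X t) 2 P := fun t => (hG.hasGaussianLaw_eval t).memLp_two
  set k : ι → ℝ := fun i => cov[X s, X (u i); P] / cov[X s, X s; P] with hkdef
  set Y : ι → Ω → ℝ := fun i ω => X (u i) ω - k i * X s ω with hYdef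
  have hY : ∀ i, Measurable (Y i) := fun i => (hX _).sub ((hX s).const_mul _)
  have hjoint : IsGaussianProcess (Sum.elim (fun _ : Unit => X s) Y) P := by
    refine hG.of_isGaussianProcess ?_
    rintro (_ | i)
    · exact ⟨{s}, .proj ⟨s, by simp⟩, fun ω => rfl⟩
    · exact ⟨{u i, s}, .proj ⟨u i, by simp⟩ - k i • .proj ⟨s, by simp⟩, fun ω => rfl⟩
  have hind : IndepFun (X s) (fun ω i => Y i ω) P := by
    have := hjoint.indepFun_of_covariance_eq_zero (fun _ => (hX s).aemeasurable)
      (fun i => (hY i).aemeasurable) fun _ i => by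
        rw [hYdef, covariance_fun_sub_right (hL2 s) (hL2 _) ((hL2 s).const_mul _),
          covariance_const_mul_right, hkdef, div_mul_cancel₀ _ hs.ne', sub_self]
    exact this.comp (measurable_pi_apply ()) measurable_id
  have hvar : (Var[X s; P].toNNReal : ℝ) = cov[X s, X s; P] := by
    rw [Real.coe_toNNReal _ (variance_nonneg _ _), covariance_self (hX s).aemeasurable]
  have hmain := _root_.measure_sup_mem_Ioc_le (hX s) (measurable_pi_lambda _ hY) hind
    (by rw [← NNReal.coe_ne_zero, hvar]; exact hs.ne')
    (hG.hasGaussianLaw_eval s).map_eq_gaussianReal hk₀ (k := k)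
    (fun i => (le_div_iff₀ hs).2 (hu i)) hb hm hh
  simp only [add_sub_cancel, hvar] at hmain
  convert hmain using 3
  ring

section Field

variable {Ω E : Type*} [MeasurableSpace Ω] {P : Measure Ω} [TopologicalSpace E]
  [SecondCountableTopology E] {f : E → Ω → ℝ} {T : Set E}

lemma measure_sup_mem_Ioc_le_of_subset (hf : ∀ t, Measurable (f t))
    (hG : IsGaussianProcess (fun t : T => f t) P) (hcont : ∀ᵐ ω ∂P, ContinuousOn (fun t => f t ω) T)
    {A : Set E} (hAT : A ⊆ T) {s : E} (hsA : s ∈ A) {k₀ : ℝ} (hk₀ : 0 < k₀)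
    (hs : 0 < cov[f s, f s; P]) (hA : ∀ t ∈ A, k₀ * cov[f s, f s; P] ≤ cov[f s, f t; P])
    {b h : ℝ} (hb : 1 ≤ b) (hm : |∫ ω, f s ω ∂P| ≤ b) (hh : 0 ≤ h) :
    P {ω | (∃ t ∈ A, b < f t ω) ∧ ∀ t ∈ A, f t ω ≤ b + h} ≤
      ENNReal.ofReal (Real.exp (5 / (2 * cov[f s, f s; P])) / k₀ * (h * b)) *
        (2 * P {ω | ∃ t ∈ T, b < f t ω}) := by
  have : Nonempty A := ⟨⟨s, hsA⟩⟩
  let u : ℕ → T := fun n => ⟨TopologicalSpace.denseSeq A n, hAT (Subtype.coe_prop _)⟩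
  have hmain := hG.measure_sup_mem_Ioc_le (fun t => hf t) (s := ⟨s, hAT hsA⟩) hk₀ hs (u := u)
    (fun n => hA _ (Subtype.coe_prop _)) hb hm hh
  refine (measure_mono_ae ?_).trans (hmain.trans (mul_le_mul_right ?_ _))
  · filter_upwards [hcont] with ω hω
    rintro ⟨⟨t, htA, ht⟩, hle⟩
    have hopen : IsOpen {x : A | b < f x ω} :=
      isOpen_Ioi.preimage (hω.mono hAT).domRestrict
    obtain ⟨n, hn⟩ := (TopologicalSpace.denseRange_denseSeq A).exists_mem_open hopen ⟨⟨t, htA⟩, ht⟩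
    exact ⟨⟨n, hn⟩, fun i => hle _ (Subtype.coe_prop _)⟩
  · rw [two_mul]
    gcongr ?_ + ?_
    · exact measure_mono fun ω ⟨n, hn⟩ => ⟨u n, (u n).2, hn⟩
    · exact measure_mono fun ω hω => ⟨s, hAT hsA, hω⟩

/-- The supremum of a continuous Gaussian field on a compact set charges `(b, b + h]` by at most a
multiple of `h * b` times the probability of exceeding level `b`, for all large `b`. -/
lemma exists_measure_sup_mem_Ioc_le [IsFiniteMeasure P] (hT : IsCompact T)
    (hf : ∀ t, Measurable (f t))
    (hG : IsGaussianProcess (fun t : T => f t) P) (hcont : ∀ᵐ ω ∂P, ContinuousOn (fun t => f t ω) T)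
    (hpos : ∀ s ∈ T, 0 < cov[f s, f s; P])
    (hloc : ∀ s ∈ T, ∃ k₀ > 0, ∀ᶠ t in nhdsWithin s T,
      k₀ * cov[f s, f s; P] ≤ cov[f s, f t; P]) :
    ∃ b₀ K : ℝ, 1 ≤ b₀ ∧ 1 ≤ K ∧ ∀ b h : ℝ, b₀ ≤ b → 0 ≤ h →
      (P {ω | (∃ t ∈ T, b < f t ω) ∧ ∀ t ∈ T, f t ω ≤ b + h}).toReal ≤
        K * (h * b) * (P {ω | ∃ t ∈ T, b < f t ω}).toReal := by
  choose! k hk0 hk using hloc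
  set V : E → Set E := fun s => {t | k s * cov[f s, f s; P] ≤ cov[f s, f t; P]}
  obtain ⟨F, hFT, hF⟩ := hT.elim_nhdsWithin_subcover V hk
  set κ : E → ℝ := fun s => Real.exp (5 / (2 * cov[f s, f s; P])) / k s
  have hκ0 : ∀ s ∈ F, 0 ≤ κ s * 2 := fun s hs => by
    have := hk0 s (hFT s hs)
    positivity
  have hm0 : 0 ≤ ∑ s ∈ F, |∫ ω, f s ω ∂P| := Finset.sum_nonneg fun _ _ => abs_nonneg _
  refine ⟨1 + ∑ s ∈ F, |∫ ω, f s ω ∂P|, 1 + ∑ s ∈ F, κ s * 2, by linarith,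
    by linarith [Finset.sum_nonneg hκ0], fun b h hb hh => ?_⟩
  have hb1 : 1 ≤ b := by linarith
  set p := P {ω | ∃ t ∈ T, b < f t ω}
  have hsub : {ω | (∃ t ∈ T, b < f t ω) ∧ ∀ t ∈ T, f t ω ≤ b + h} ⊆
      ⋃ s ∈ F, {ω | (∃ t ∈ T ∩ V s, b < f t ω) ∧ ∀ t ∈ T ∩ V s, f t ω ≤ b + h} := by
    rintro ω ⟨⟨t, htT, ht⟩, hle⟩
    obtain ⟨s, hs, hts⟩ := Set.mem_iUnion₂.1 (hF htT)
    exact Set.mem_iUnion₂.2 ⟨s, hs, ⟨t, ⟨htT, hts⟩, ht⟩, fun t' ht' => hle t' ht'.1⟩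
  have hbound : P {ω | (∃ t ∈ T, b < f t ω) ∧ ∀ t ∈ T, f t ω ≤ b + h} ≤
      ∑ s ∈ F, ENNReal.ofReal (κ s * (h * b)) * (2 * p) := by
    refine (measure_mono hsub).trans ((measure_biUnion_finset_le _ _).trans ?_)
    refine Finset.sum_le_sum fun s hs => ?_
    have hsT := hFT s hs
    refine measure_sup_mem_Ioc_le_of_subset hf hG hcont Set.inter_subset_left
      ⟨hsT, mem_of_mem_nhdsWithin hsT (hk s hsT)⟩ (hk0 s hsT) (hpos s hsT) (fun t ht => ht.2) hb1
      ?_ hh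
    have := Finset.single_le_sum (f := fun s => |∫ ω, f s ω ∂P|) (fun _ _ => abs_nonneg _) hs
    linarith
  have hfin : ∀ s ∈ F, ENNReal.ofReal (κ s * (h * b)) * (2 * p) ≠ ⊤ := fun s _ =>
    ENNReal.mul_ne_top ENNReal.ofReal_ne_top (ENNReal.mul_ne_top (by simp) (measure_ne_top _ _))
  refine (ENNReal.toReal_mono (ENNReal.sum_ne_top.2 hfin) hbound).trans ?_
  rw [ENNReal.toReal_sum hfin, add_mul, add_mul, Finset.sum_mul, Finset.sum_mul]
  refine le_add_of_nonneg_of_le (by positivity) (Finset.sum_le_sum fun s hs => ?_)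
  have := hκ0 s hs
  rw [ENNReal.toReal_mul, ENNReal.toReal_mul, ENNReal.toReal_ofReal (by
    have : 0 ≤ κ s := by linarith
    positivity)]
  simp only [ENNReal.toReal_ofNat]
  exact le_of_eq (by ring)

end Field

lemma continuous_nrm {d : ℕ} : Continuous (nrm : (Fin d → ℝ) → ℝ) := by
  unfold nrm
  fun_prop

/-- Proposition `PropDensity`.  Under Conditions A1–A4 with Hölder
exponent `β`: for any `v > 0`, with `ρ = 2d/β + dv + 1`, there exist `b₀, λ ∈ (0,∞)`,
independent of `a > 0`, such that for all `b ≥ b₀ ≥ 1`: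
(i) `P(max_{t∈T} f(t) ≤ b + a/b | max_{t∈T} f(t) > b) ≤ λ a b^ρ`;
(ii) `P(max_{t∈T} f(t) > γ_{a,b}, max_{t∈T} f(t) ≤ b) ≤ λ a b^ρ P(max_{t∈T} f(t) > γ_{a,b})`;
(iii) `P(max_{t∈T} f(t) > γ_{a,b}) (1 − λ a b^ρ) ≤ P(max_{t∈T} f(t) > b)`,
where `γ_{a,b} = b − a/b`. -/
theorem overshoot_density_bound
    {Ω : Type} [MeasureSpace Ω] [IsProbabilityMeasure (ℙ : Measure Ω)]
    {d : ℕ} (hd : 0 < d)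
    (T : Set (Fin d → ℝ)) (hTcompact : IsCompact T) (h0T : (0 : Fin d → ℝ) ∈ T)
    (f : (Fin d → ℝ) → Ω → ℝ) (hfmeas : ∀ t, Measurable (f t))
    -- `f` is a Gaussian random field on `T`
    (hGauss : ∀ (n : ℕ) (t : Fin n → (Fin d → ℝ)), (∀ i, t i ∈ T) →
      ∀ c : Fin n → ℝ, ∃ (m : ℝ) (v : NNReal),
        Measure.map (fun ω => ∑ i, c i * f (t i) ω) (ℙ : Measure Ω) = gaussianReal m v)
    -- mean, covariance and standard deviation functions
    (μ : (Fin d → ℝ) → ℝ) (C : (Fin d → ℝ) → (Fin d → ℝ) → ℝ) (σ : (Fin d → ℝ) → ℝ)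
    (hμ : ∀ t ∈ T, μ t = ∫ ω, f t ω)
    (hC : ∀ s ∈ T, ∀ t ∈ T, C s t = ∫ ω, (f s ω - μ s) * (f t ω - μ t))
    (hσ : ∀ t ∈ T, σ t = Real.sqrt (C t t)) (hσpos : ∀ t ∈ T, 0 < σ t)
    -- Condition A1: almost sure continuity on T
    (hA1 : ∀ᵐ ω ∂(ℙ : Measure Ω), ContinuousOn (fun t => f t ω) T)
    -- Conditions A2 and A3, with Hölder exponent `β` and constant `κH`
    (β κH δ : ℝ) (hβ : 0 < β) (hκH : 0 < κH) (hδ : 0 < δ)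
    (hA2 : ∀ s ∈ T, ∀ t ∈ T, nrm (s - t) < δ →
      |σ t - σ s| + |μ t - μ s| ≤ κH * nrm (s - t) ^ β)
    (hA3 : ∀ s ∈ T, ∀ s' ∈ T, ∀ t ∈ T, ∀ t' ∈ T,
      nrm (t - t') < δ → nrm (s - s') < δ →
      |C t s / (σ t * σ s) - C t' s' / (σ t' * σ s')| ≤
        κH * (nrm (t - t') ^ β + nrm (s - s') ^ β))
    -- Condition A4
    (κ₀ ε₁ : ℝ) (hκ₀ : 0 < κ₀) (hε₁ : 0 < ε₁)
    (hA4 : ∀ t ∈ T, ∀ ε : ℝ, 0 < ε → ε < ε₁ →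
      κ₀ * ε ^ d * (volume {x : Fin d → ℝ | nrm x ≤ 1}).toReal ≤
        (volume ({s | nrm (s - t) ≤ ε} ∩ T)).toReal)
    :
    ∀ v : ℝ, 0 < v →
      ∃ b₀ lam : ℝ, 1 ≤ b₀ ∧ 0 < lam ∧
        ∀ a : ℝ, 0 < a → ∀ b : ℝ, b₀ ≤ b →
          ((ℙ ({ω | ∀ t ∈ T, f t ω ≤ b + a / b} ∩ {ω | ∃ t ∈ T, f t ω > b})).toReal /
              (ℙ {ω | ∃ t ∈ T, f t ω > b}).toReal
            ≤ lam * a * b ^ (2 * (d : ℝ) / β + (d : ℝ) * v + 1)) ∧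
          ((ℙ {ω | (∃ t ∈ T, f t ω > b - a / b) ∧ ∀ t ∈ T, f t ω ≤ b}).toReal
            ≤ lam * a * b ^ (2 * (d : ℝ) / β + (d : ℝ) * v + 1) *
                (ℙ {ω | ∃ t ∈ T, f t ω > b - a / b}).toReal) ∧
          ((ℙ {ω | ∃ t ∈ T, f t ω > b - a / b}).toReal *
              (1 - lam * a * b ^ (2 * (d : ℝ) / β + (d : ℝ) * v + 1))
            ≤ (ℙ {ω | ∃ t ∈ T, f t ω > b}).toReal) := by
  intro v hv
  have hG : IsGaussianProcess (fun t : T => f t) (ℙ : Measure Ω) :=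
    isGaussianProcess_of_forall_linearCombination (fun t => hfmeas t)
      fun n t c => hGauss n (fun i => t i) (fun i => (t i).2) c
  have hcov : ∀ s ∈ T, ∀ t ∈ T, cov[f s, f t; ℙ] = C s t := fun s hs t ht => by
    rw [hC s hs t ht, covariance, hμ s hs, hμ t ht]
  have hCpos : ∀ t ∈ T, 0 < C t t := fun t ht => Real.sqrt_pos.1 (hσ t ht ▸ hσpos t ht)
  have hσsq : ∀ t ∈ T, C t t = σ t * σ t := fun t ht => by
    rw [hσ t ht, Real.mul_self_sqrt (hCpos t ht).le]
  have hloc : ∀ s ∈ T, ∃ k₀ > (0 : ℝ), ∀ᶠ t in nhdsWithin s T,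
      k₀ * cov[f s, f s; ℙ] ≤ cov[f s, f t; ℙ] := by
    intro s hs
    have hσs := hσpos s hs
    have hcont : Continuous fun t : Fin d → ℝ => nrm (s - t) := continuous_nrm.comp (by fun_prop)
    have hcontβ : Continuous fun t : Fin d → ℝ => κH * nrm (s - t) ^ β :=
      (hcont.rpow_const fun _ => Or.inr hβ.le).const_mul _
    have hzero : nrm (s - s) = 0 := by simp [nrm]
    have hzeroβ : κH * nrm (s - s) ^ β = 0 := by rw [hzero, Real.zero_rpow hβ.ne', mul_zero]
    have h1 : ∀ᶠ t in nhdsWithin s T, nrm (s - t) < δ :=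
      (hcont.tendsto s).mono_left nhdsWithin_le_nhds |>.eventually_lt_const (by rwa [hzero])
    have h2 : ∀ᶠ t in nhdsWithin s T, κH * nrm (s - t) ^ β < min (1 / 2) (σ s / 2) :=
      (hcontβ.tendsto s).mono_left nhdsWithin_le_nhds |>.eventually_lt_const (by
        rw [hzeroβ]; positivity)
    refine ⟨1 / 4, by norm_num, ?_⟩
    filter_upwards [h1, h2, self_mem_nhdsWithin] with t ht1 ht2 htT
    rw [hcov s hs s hs, hcov s hs t htT]
    have hσt := hσpos t htT
    obtain ⟨hr, hσst⟩ := lt_min_iff.1 ht2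
    have hA2' := hA2 s hs t htT ht1
    have hA3' := hA3 t htT s hs s hs s hs (by rwa [hzero]) (by
      rwa [show nrm (t - s) = nrm (s - t) by simp [nrm, abs_sub_comm]])
    rw [show nrm (t - s) = nrm (s - t) by simp [nrm, abs_sub_comm], mul_add, hzeroβ, zero_add,
      hσsq s hs, div_self (by positivity)] at hA3'
    have hσhalf : σ s / 2 ≤ σ t := by
      linarith [neg_abs_le (σ t - σ s), abs_nonneg (μ t - μ s)]
    have hrhalf : 1 / 2 ≤ C s t / (σ s * σ t) := by
      linarith [neg_abs_le (C s t / (σ s * σ t) - 1)]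
    rw [le_div_iff₀ (by positivity)] at hrhalf
    rw [hσsq s hs]
    nlinarith
  obtain ⟨b₁, K, hb₁, hK, hmain⟩ := exists_measure_sup_mem_Ioc_le hTcompact hfmeas hG hA1
    (fun s hs => by rw [hcov s hs s hs]; exact hCpos s hs) hloc
  have hK0 : 0 < K := by linarith
  refine ⟨b₁ + 1, K, by linarith, hK0, fun a ha b hb => ?_⟩
  have hb0 : 0 < b := by linarith
  have hpow : 1 ≤ b ^ (2 * (d : ℝ) / β + (d : ℝ) * v + 1) :=
    Real.one_le_rpow (by linarith) (by positivity)
  set R := b ^ (2 * (d : ℝ) / β + (d : ℝ) * v + 1)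
  have hKaR : K * a ≤ K * a * R := le_mul_of_one_le_right (by positivity) hpow
  have hdrop : (ℙ {ω | (∃ t ∈ T, f t ω > b - a / b) ∧ ∀ t ∈ T, f t ω ≤ b}).toReal ≤
      K * a * R * (ℙ {ω | ∃ t ∈ T, f t ω > b - a / b}).toReal := by
    by_cases hKa : 1 ≤ K * a
    · refine (ENNReal.toReal_mono (measure_ne_top _ _) (measure_mono fun ω hω => hω.1)).trans ?_
      exact le_mul_of_one_le_left ENNReal.toReal_nonneg (by linarith)
    · have ha1 : a < 1 := by nlinarith
      have hab : a / b ≤ 1 := (div_le_one hb0).2 (by linarith)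
      have h := hmain (b - a / b) (a / b) (by linarith) (by positivity)
      rw [sub_add_cancel] at h
      refine h.trans (mul_le_mul_of_nonneg_right (le_trans ?_ hKaR) ENNReal.toReal_nonneg)
      have : a / b * (b - a / b) ≤ a := by
        calc a / b * (b - a / b) ≤ a / b * b := by
              gcongr
              linarith [div_pos ha hb0]
          _ = a := div_mul_cancel₀ a hb0.ne'
      gcongr
  refine ⟨?_, hdrop, ?_⟩
  · refine div_le_of_le_mul₀ ENNReal.toReal_nonneg (by positivity) ?_
    rw [Set.inter_comm]
    have h := hmain b (a / b) (by linarith) (by positivity)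
    rw [div_mul_cancel₀ a hb0.ne'] at h
    exact h.trans (mul_le_mul_of_nonneg_right hKaR ENNReal.toReal_nonneg)
  · have hsplit : (ℙ {ω | ∃ t ∈ T, f t ω > b - a / b}).toReal ≤
        (ℙ {ω | (∃ t ∈ T, f t ω > b - a / b) ∧ ∀ t ∈ T, f t ω ≤ b}).toReal +
          (ℙ {ω | ∃ t ∈ T, f t ω > b}).toReal := by
      refine (measureReal_mono (fun ω hω => ?_)).trans (measureReal_union_le _ _)
      by_cases h : ∃ t ∈ T, f t ω > b
      · exact Or.inr h
      · push Not at h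
        exact Or.inl ⟨hω, h⟩
    linarith
end
end
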